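/- In the representation of the Boolean algebra of conditionals, for all events A, C, D ⊆ Ω and every nonempty event B ⊆ Ω: (i) ⟦A∣B⟧ equals the set of all enumerations if and only if B ⊆ A; (ii) if A ⊆ C then ⟦A∣B⟧ ⊆ ⟦C∣B⟧, and A ⊆ C if and only if ⟦A∣Ω⟧ ⊆ ⟦C∣Ω⟧; (iii) if A ⊆ B ⊆ D then ⟦A∣D⟧ ⊆ ⟦A∣B⟧; (iv) ⟦A∩B∣Ω⟧ ⊆ ⟦A∣B⟧ ⊆ ⟦(Ω∖B)∪A∣Ω⟧; (v) if A∩D = ∅ and ∅ ≠ A ⊆ B then ⟦A∣Ω⟧ ∩ ⟦D∣B⟧ = ∅; (vi) (modus ponens) ⟦B∣Ω⟧ ∩ ⟦A∣B⟧ ⊆ ⟦A∣Ω⟧. -/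

import Mathlib

open Finset

variable {Ω : Type*}

noncomputable def sigmaFirst [Fintype Ω] [DecidableEq Ω] [Nonempty Ω]
    (σ : Fin (Fintype.card Ω) ≃ Ω) (B : Finset Ω) : Ω :=
  if h : (Finset.univ.filter fun i => σ i ∈ B).Nonempty then
    σ ((Finset.univ.filter fun i => σ i ∈ B).min' h)
  else Classical.arbitrary Ω

def condEvent [Fintype Ω] [DecidableEq Ω] [Nonempty Ω]
    (A B : Finset Ω) : Set (Fin (Fintype.card Ω) ≃ Ω) :=
  {σ | sigmaFirst σ B ∈ A}

section

variable [Fintype Ω] [DecidableEq Ω] [Nonempty Ω]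

theorem sigmaFirst_mem (σ : Fin (Fintype.card Ω) ≃ Ω) {B : Finset Ω} (hB : B.Nonempty) :
    sigmaFirst σ B ∈ B := by
  obtain ⟨b, hb⟩ := hB
  have h : (Finset.univ.filter fun i => σ i ∈ B).Nonempty := ⟨σ.symm b, by simpa using hb⟩
  rw [sigmaFirst, dif_pos h]
  exact (Finset.mem_filter.1 (Finset.min'_mem _ h)).2

theorem symm_sigmaFirst_le (σ : Fin (Fintype.card Ω) ≃ Ω) {B : Finset Ω} {x : Ω} (hx : x ∈ B) :
    σ.symm (sigmaFirst σ B) ≤ σ.symm x := by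
  have hx' : σ.symm x ∈ Finset.univ.filter fun i => σ i ∈ B := by simpa using hx
  rw [sigmaFirst, dif_pos ⟨_, hx'⟩, Equiv.symm_apply_apply]
  exact Finset.min'_le _ _ hx'

theorem sigmaFirst_eq_of_forall_le (σ : Fin (Fintype.card Ω) ≃ Ω) {B : Finset Ω} {b : Ω}
    (hb : b ∈ B) (h : ∀ x ∈ B, σ.symm b ≤ σ.symm x) : sigmaFirst σ B = b :=
  σ.symm.injective
    (le_antisymm (symm_sigmaFirst_le σ hb) (h _ (sigmaFirst_mem σ ⟨b, hb⟩)))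

theorem sigmaFirst_eq_of_subset (σ : Fin (Fintype.card Ω) ≃ Ω) {B D : Finset Ω} (hBD : B ⊆ D)
    (h : sigmaFirst σ D ∈ B) : sigmaFirst σ B = sigmaFirst σ D :=
  sigmaFirst_eq_of_forall_le σ h fun _ hx => symm_sigmaFirst_le σ (hBD hx)

theorem exists_sigmaFirst_eq {B : Finset Ω} {b : Ω} (hb : b ∈ B) :
    ∃ σ : Fin (Fintype.card Ω) ≃ Ω, sigmaFirst σ B = b := by
  let e := (Fintype.equivFin Ω).symm
  let i : Fin (Fintype.card Ω) := ⟨0, Fintype.card_pos⟩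
  refine ⟨e.trans (Equiv.swap (e i) b), sigmaFirst_eq_of_forall_le _ hb fun x _ => ?_⟩
  have h : (e.trans (Equiv.swap (e i) b)).symm b = i := by simp
  rw [h]
  exact Nat.zero_le _

end

theorem stmt3 [Fintype Ω] [DecidableEq Ω] [Nonempty Ω]
    (A C D B : Finset Ω) (hB : B.Nonempty) :
    (condEvent A B = (Set.univ : Set (Fin (Fintype.card Ω) ≃ Ω)) ↔ B ⊆ A) ∧
    (A ⊆ C → condEvent A B ⊆ condEvent C B) ∧
    (A ⊆ C ↔ condEvent A (Finset.univ : Finset Ω) ⊆ condEvent C Finset.univ) ∧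
    (A ⊆ B → B ⊆ D → condEvent A D ⊆ condEvent A B) ∧
    condEvent (A ∩ B) (Finset.univ : Finset Ω) ⊆ condEvent A B ∧
    condEvent A B ⊆ condEvent ((Finset.univ \ B) ∪ A) (Finset.univ : Finset Ω) ∧
    (A ∩ D = ∅ → A.Nonempty → A ⊆ B →
      condEvent A (Finset.univ : Finset Ω) ∩ condEvent D B = ∅) ∧
    condEvent B (Finset.univ : Finset Ω) ∩ condEvent A B ⊆
      condEvent A (Finset.univ : Finset Ω) := by
  have key (σ : Fin (Fintype.card Ω) ≃ Ω) (h : sigmaFirst σ Finset.univ ∈ B) :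
      sigmaFirst σ B = sigmaFirst σ Finset.univ :=
    sigmaFirst_eq_of_subset σ (Finset.subset_univ B) h
  refine ⟨⟨fun h b hb => ?_, fun h => ?_⟩, fun h σ hσ => h hσ,
    ⟨fun h σ hσ => h hσ, fun h a ha => ?_⟩, fun hAB hBD σ hσ => ?_, fun σ hσ => ?_,
    fun σ hσ => ?_, fun hAD _ hAB => ?_, fun σ hσ => ?_⟩
  · obtain ⟨σ, rfl⟩ := exists_sigmaFirst_eq hb
    exact Set.eq_univ_iff_forall.1 h σ
  · exact Set.eq_univ_of_forall fun σ => h (sigmaFirst_mem σ hB)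
  · obtain ⟨σ, rfl⟩ := exists_sigmaFirst_eq (Finset.mem_univ a)
    exact h ha
  · change sigmaFirst σ B ∈ A
    rw [sigmaFirst_eq_of_subset σ hBD (hAB hσ)]
    exact hσ
  · have h := Finset.mem_inter.1 hσ
    change sigmaFirst σ B ∈ A
    rw [key σ h.2]
    exact h.1
  · change sigmaFirst σ Finset.univ ∈ (Finset.univ \ B) ∪ A
    by_cases h : sigmaFirst σ Finset.univ ∈ B
    · exact Finset.mem_union_right _ (key σ h ▸ hσ)
    · simp [h]
  · refine Set.eq_empty_of_forall_notMem fun σ hσ => ?_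
    have hA : sigmaFirst σ Finset.univ ∈ A := hσ.1
    have hD : sigmaFirst σ B ∈ D := hσ.2
    rw [key σ (hAB hA)] at hD
    exact Finset.notMem_empty _ (hAD ▸ Finset.mem_inter.2 ⟨hA, hD⟩)
  · have h : sigmaFirst σ B ∈ A := hσ.2
    rwa [key σ hσ.1] at h
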